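/- Let X be a topological space with finitely many connected components and let f : X → X be a homeomorphism. Then f permutes the connected components of X; let R be a set of representatives of the orbits of this permutation, and for each component N ∈ R let n_N ≥ 1 be the cardinality of its orbit and let g_N : N → N be the restriction of f^{n_N} to N (note that f^{n_N} maps N homeomorphically onto itself, and n_N is the smallest positive integer with this property). Then the mapping torus X_f is homeomorphic to the disjoint union ⊔_{N ∈ R} N_{g_N} of the mapping tori of the maps g_N. -/

import Mathlib

universe u

noncomputable section

/-- The generating relation for the mapping torus of `f : X → X`: the point `(x, 1)`
is identified with `(f x, 0)`. -/
def mappingTorusRel {X : Type u} (f : X → X) :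
    X × unitInterval → X × unitInterval → Prop :=
  fun p q => p.2 = 1 ∧ q.2 = 0 ∧ q.1 = f p.1

/-- The mapping torus of `f : X → X`: the quotient of `X × [0,1]` by the finest
equivalence relation identifying `(x, 1)` with `(f x, 0)`, with the quotient topology. -/
abbrev MappingTorus {X : Type u} (f : X → X) : Type u :=
  Quot (mappingTorusRel f)

/-- The permutation of the connected components induced by a homeomorphism. -/
def Homeomorph.componentsPerm {X : Type u} [TopologicalSpace X] (f : X ≃ₜ X) :
    Equiv.Perm (ConnectedComponents X) where
  toFun := f.continuous.connectedComponentsMap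
  invFun := f.symm.continuous.connectedComponentsMap
  left_inv c := by
    obtain ⟨x, rfl⟩ := ConnectedComponents.surjective_coe c
    simp only [Continuous.connectedComponentsMap_mk, Homeomorph.symm_apply_apply]
  right_inv c := by
    obtain ⟨x, rfl⟩ := ConnectedComponents.surjective_coe c
    simp only [Continuous.connectedComponentsMap_mk, Homeomorph.apply_symm_apply]

namespace Homeomorph

variable {X : Type u} [TopologicalSpace X]

theorem componentsPerm_mk (f : X ≃ₜ X) (x : X) :
    f.componentsPerm (ConnectedComponents.mk x) = ConnectedComponents.mk (f x) :=
  rfl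

theorem componentsPerm_pow_mk (f : X ≃ₜ X) (k : ℕ) (x : X) :
    (f.componentsPerm ^ k) (ConnectedComponents.mk x) = ConnectedComponents.mk ((⇑f)^[k] x) := by
  induction k with
  | zero => rfl
  | succ k ih =>
    rw [pow_succ', Equiv.Perm.mul_apply, ih, componentsPerm_mk, Function.iterate_succ_apply']

theorem componentsPerm_zpow_mk (f : X ≃ₜ X) (k : ℤ) (x : X) :
    (f.componentsPerm ^ k) (ConnectedComponents.mk x) =
      ConnectedComponents.mk ((f.toEquiv ^ k) x) := by
  have hpow (m : ℕ) (y : X) : (f.componentsPerm ^ m) (ConnectedComponents.mk y) =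
      ConnectedComponents.mk ((f.toEquiv ^ m) y) := by
    rw [componentsPerm_pow_mk, Equiv.Perm.coe_pow]
    rfl
  obtain ⟨m, rfl | rfl⟩ := k.eq_nat_or_neg
  · simpa only [zpow_natCast] using hpow m x
  · rw [zpow_neg, zpow_neg, zpow_natCast, zpow_natCast, Equiv.Perm.inv_eq_iff_eq, hpow,
      ← Equiv.Perm.mul_apply, mul_inv_cancel, Equiv.Perm.one_apply]

end Homeomorph

/-- If `R` meets every orbit of `σ` exactly once and the orbit of `r ∈ R` has `n r` elements,
then every element is `σ ^ j r` for unique `r ∈ R` and `j < n r`. -/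
theorem Equiv.Perm.bijective_pow_representatives {C : Type*} (σ : Equiv.Perm C) {R : Set C}
    (hR : ∀ c, ∃! r, r ∈ R ∧ ∃ k : ℤ, (σ ^ k) r = c) {n : R → ℕ}
    (hn : ∀ r : R, IsLeast {k : ℕ | 0 < k ∧ (σ ^ k) (r : C) = r} (n r)) :
    Function.Bijective fun a : Σ r : R, Fin (n r) => (σ ^ (a.2 : ℕ)) (a.1 : C) := by
  constructor
  · have aux (r : R) (i j : ℕ) (hij : i < j) (hj : j < n r) :
        (σ ^ i) (r : C) ≠ (σ ^ j) (r : C) := by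
      intro h
      have h' : (σ ^ (j - i)) (r : C) = r := by
        apply (σ ^ i).injective
        rw [← Equiv.Perm.mul_apply, ← pow_add, h]
        congr 2
        omega
      have := (hn r).2 ⟨Nat.sub_pos_of_lt hij, h'⟩
      omega
    rintro ⟨r, i⟩ ⟨s, j⟩ h
    dsimp only at h
    obtain rfl : r = s := Subtype.ext <| (hR ((σ ^ (i : ℕ)) (r : C))).unique
      ⟨r.2, (i : ℕ), by rw [zpow_natCast]⟩ ⟨s.2, (j : ℕ), by rw [zpow_natCast, h]⟩
    obtain hlt | heq | hgt := lt_trichotomy (i : ℕ) j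
    · exact absurd h (aux r i j hlt j.2)
    · rw [Fin.ext heq]
    · exact absurd h.symm (aux r j i hgt i.2)
  · intro c
    obtain ⟨r, ⟨hr, k, hk⟩, -⟩ := hR c
    obtain ⟨hpos, hfix⟩ := (hn ⟨r, hr⟩).1
    set m := n ⟨r, hr⟩ with hm
    have hm0 : (0 : ℤ) < m := by exact_mod_cast hpos
    have h0 : 0 ≤ k % m := Int.emod_nonneg _ hm0.ne'
    have h1 : k % m < m := Int.emod_lt_of_pos _ hm0
    refine ⟨⟨⟨r, hr⟩, ⟨(k % m).toNat, by omega⟩⟩, ?_⟩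
    dsimp only
    rw [← hk, ← zpow_natCast, Int.toNat_of_nonneg h0]
    conv_rhs => rw [← Int.emod_add_mul_ediv k m, zpow_add, Equiv.Perm.mul_apply, zpow_mul,
      zpow_natCast, Equiv.Perm.zpow_apply_eq_self_of_apply_eq_self hfix]

namespace MappingTorus

variable {X : Type u}

/-- The point reached from `[x, 0]` after time `s ≥ 0` by the suspension semiflow. -/
def flow (f : X → X) (x : X) (s : ℝ) : MappingTorus f :=
  Quot.mk _ (f^[⌊s⌋₊] x, Set.projIcc 0 1 zero_le_one (s - ⌊s⌋₊))

theorem mk_one (f : X → X) (x : X) :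
    (Quot.mk _ (x, 1) : MappingTorus f) = Quot.mk _ (f x, 0) :=
  Quot.sound ⟨rfl, rfl, rfl⟩

theorem flow_natCast_add (f : X → X) (x : X) (k : ℕ) (t : unitInterval) :
    flow f x (k + t) = Quot.mk _ (f^[k] x, t) := by
  obtain rfl | ht := eq_or_ne t 1
  · have h : (k : ℝ) + ((1 : unitInterval) : ℝ) = ((k + 1 : ℕ) : ℝ) := by simp
    rw [mk_one, ← Function.iterate_succ_apply' f, flow, h, Nat.floor_natCast, sub_self,
      Set.projIcc_left]
    rfl
  · have ht' : (t : ℝ) < 1 := unitInterval.coe_lt_one.2 (unitInterval.lt_one_iff_ne_one.2 ht)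
    have h : ⌊(k : ℝ) + t⌋₊ = k :=
      (Nat.floor_eq_iff (by have := t.2.1; positivity)).2 ⟨by linarith [t.2.1], by linarith⟩
    rw [flow, h, add_sub_cancel_left, Set.projIcc_val]

theorem flow_eq (f : X → X) (x : X) {k : ℕ} {s : ℝ} (h₀ : k ≤ s) (h₁ : s ≤ k + 1) :
    flow f x s = Quot.mk _ (f^[k] x, Set.projIcc 0 1 zero_le_one (s - k)) := by
  have hs : s - k ∈ Set.Icc (0 : ℝ) 1 := ⟨by linarith, by linarith⟩
  rw [← flow_natCast_add, Set.projIcc_of_mem _ hs]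
  simp

theorem exists_lt_mul_eq_add {n : ℕ} (hn : 0 < n) (t : unitInterval) :
    ∃ j < n, ∃ s : unitInterval, (n : ℝ) * t = j + s := by
  have hn' : (0 : ℝ) < n := by exact_mod_cast hn
  have h0 : 0 ≤ (n : ℝ) * t := mul_nonneg hn'.le t.2.1
  obtain rfl | ht := eq_or_ne t 1
  · refine ⟨n - 1, by omega, 1, ?_⟩
    rw [Nat.cast_sub hn]
    simp
  · have ht' : (t : ℝ) < 1 := unitInterval.coe_lt_one.2 (unitInterval.lt_one_iff_ne_one.2 ht)
    refine ⟨⌊(n : ℝ) * t⌋₊, (Nat.floor_lt h0).2 (by nlinarith), ⟨n * t - ⌊(n : ℝ) * t⌋₊, ?_, ?_⟩, ?_⟩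
    · linarith [Nat.floor_le h0]
    · linarith [Nat.lt_floor_add_one ((n : ℝ) * t)]
    · simp

theorem continuous_flow_mul [TopologicalSpace X] {f : X → X} (hf : Continuous f) {n : ℕ}
    (hn : 0 < n) : Continuous fun p : X × unitInterval => flow f p.1 (n * p.2) := by
  refine (locallyFinite_of_finite fun j : Fin n =>
    {p : X × unitInterval | (j : ℝ) ≤ n * p.2 ∧ (n : ℝ) * p.2 ≤ j + 1}).continuous ?_ ?_ ?_
  · refine Set.eq_univ_of_forall fun p => ?_
    obtain ⟨j, hj, s, hs⟩ := exists_lt_mul_eq_add hn p.2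
    refine Set.mem_iUnion.2 ⟨⟨j, hj⟩, ?_⟩
    constructor <;> dsimp only <;> linarith [s.2.1, s.2.2]
  · intro j
    have h : Continuous fun p : X × unitInterval => (n : ℝ) * p.2 := by fun_prop
    exact (isClosed_le continuous_const h).inter (isClosed_le h continuous_const)
  · intro j
    refine ContinuousOn.congr (Continuous.continuousOn ?_) fun p hp => flow_eq f p.1 hp.1 hp.2
    have := hf.iterate j
    exact continuous_quot_mk.comp
      ((this.comp continuous_fst).prodMk (continuous_projIcc.comp (by fun_prop)))

end MappingTorus

/-- Let `X` be a topological space with finitely many connected components and `f : X ≃ₜ X`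
a homeomorphism, so that `f` permutes the connected components of `X`.  Let
`R` be a set of representatives of the orbits of this permutation (hypothesis `hR`: every
component lies in the orbit of exactly one member of `R`).  For each `N ∈ R`, let `n N ≥ 1`
be the smallest positive integer such that `f ^ (n N)` maps the component `N` onto itself,
i.e. the cardinality of the orbit of `N` (hypothesis `hn`), and let `g N` be the restriction
of `f ^ (n N)` to the component `N` (hypothesis `hg`).  Then the mapping torus `X_f` is
homeomorphic to the disjoint union of the mapping tori of the maps `g N`, `N ∈ R`. -/
theorem mappingTorus_homeomorph_sigma_of_components {X : Type u} [TopologicalSpace X]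
    [Finite (ConnectedComponents X)] (f : X ≃ₜ X)
    (R : Set (ConnectedComponents X))
    (hR : ∀ c : ConnectedComponents X, ∃! r, r ∈ R ∧
      ∃ (k : ℤ) (x : X), ConnectedComponents.mk x = r ∧
        ConnectedComponents.mk ((f.toEquiv ^ k) x) = c)
    (n : R → ℕ)
    (hn : ∀ N : R, IsLeast {k : ℕ | 0 < k ∧
      ∀ x : X, ConnectedComponents.mk x = (N : ConnectedComponents X) →
        ConnectedComponents.mk ((⇑f)^[k] x) = (N : ConnectedComponents X)} (n N))
    (g : ∀ N : R, {x : X // ConnectedComponents.mk x = (N : ConnectedComponents X)} →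
      {x : X // ConnectedComponents.mk x = (N : ConnectedComponents X)})
    (hg : ∀ (N : R)
      (x : {x : X // ConnectedComponents.mk x = (N : ConnectedComponents X)}),
      (g N x : X) = (⇑f)^[n N] (x : X)) :
    Nonempty (MappingTorus (⇑f) ≃ₜ (Σ N : R, MappingTorus (g N))) := by
  have hpos (N : R) : 0 < n N := (hn N).1.1
  have hbij := f.componentsPerm.bijective_pow_representatives (R := R) (n := n)
    (fun c => by
      refine (existsUnique_congr fun r => and_congr_right fun _ => ?_).mpr (hR c)
      constructor
      · rintro ⟨k, hk⟩
        obtain ⟨x, rfl⟩ := ConnectedComponents.surjective_coe r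
        exact ⟨k, x, rfl, by rw [← f.componentsPerm_zpow_mk, hk]⟩
      · rintro ⟨k, x, rfl, hk⟩
        exact ⟨k, by rw [f.componentsPerm_zpow_mk, hk]⟩)
    (fun N => by
      convert hn N using 3 with k
      refine and_congr_right fun _ => ?_
      obtain ⟨x, hx⟩ := ConnectedComponents.surjective_coe (N : ConnectedComponents X)
      constructor
      · intro h y hy
        rw [← f.componentsPerm_pow_mk, hy, h]
      · intro h
        rw [← hx, f.componentsPerm_pow_mk, h x hx, hx])
  have hright (j : ℕ) (x : X) : (⇑f)^[j] ((⇑f.symm)^[j] x) = x := (f.right_inv.iterate j) x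
  let e := Equiv.ofBijective _ hbij
  have hmem (a : Σ N : R, Fin (n N)) (x : X) (h : ConnectedComponents.mk x = e a) :
      ConnectedComponents.mk ((⇑f.symm)^[a.2] x) = (a.1 : ConnectedComponents X) := by
    apply (f.componentsPerm ^ (a.2 : ℕ)).injective
    rw [f.componentsPerm_pow_mk, hright, h]
    rfl
  have hIcc (a : Σ N : R, Fin (n N)) (t : unitInterval) :
      ((a.2 : ℕ) + t : ℝ) / n a.1 ∈ unitInterval := by
    have h : ((a.2 : ℕ) + 1 : ℝ) ≤ n a.1 := by exact_mod_cast a.2.2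
    have := t.2.1
    refine ⟨by positivity, div_le_one_of_le₀ ?_ (by positivity)⟩
    linarith [t.2.2]
  -- the inverse map on the product of a single component with the unit interval
  let piece (a : Σ N : R, Fin (n N)) (p : X × unitInterval)
      (h : ConnectedComponents.mk p.1 = e a) : Σ N : R, MappingTorus (g N) :=
    ⟨a.1, Quot.mk _ (⟨(⇑f.symm)^[a.2] p.1, hmem a p.1 h⟩, ⟨_, hIcc a p.2⟩)⟩
  let ψ (p : X × unitInterval) : Σ N : R, MappingTorus (g N) :=
    piece (e.symm (ConnectedComponents.mk p.1)) p (e.apply_symm_apply _).symm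
  have hψ (a p h) : ψ p = piece a p h := by
    obtain rfl : a = e.symm (ConnectedComponents.mk p.1) := by rw [h, e.symm_apply_apply]
    rfl
  have hψ_apply (N : R) (y : {x : X // ConnectedComponents.mk x = (N : ConnectedComponents X)})
      (j : ℕ) (hj : j < n N) (t s : unitInterval) (hs : (n N : ℝ) * s = j + t) :
      ψ ((⇑f)^[j] y, t) = ⟨N, Quot.mk _ (y, s)⟩ := by
    have h : ConnectedComponents.mk ((⇑f)^[j] (y : X)) = e ⟨N, j, hj⟩ := by
      rw [← f.componentsPerm_pow_mk, y.2]
      rfl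
    rw [hψ ⟨N, j, hj⟩ _ h]
    have h1 : (⟨(⇑f.symm)^[j] ((⇑f)^[j] (y : X)), hmem ⟨N, j, hj⟩ _ h⟩ :
        {x : X // ConnectedComponents.mk x = (N : ConnectedComponents X)}) = y :=
      Subtype.ext ((f.left_inv.iterate j) y)
    have h2 : (⟨_, hIcc ⟨N, j, hj⟩ t⟩ : unitInterval) = s := by
      have : (n N : ℝ) ≠ 0 := by exact_mod_cast (hpos N).ne'
      refine Subtype.ext ?_
      dsimp only
      rw [← hs, mul_div_cancel_left₀ _ this]
    dsimp only [piece]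
    rw [h1, h2]
  have hψ_cont : Continuous ψ := by
    have : Finite (Σ N : R, Fin (n N)) := Finite.of_equiv _ e.symm
    have hopen (c : ConnectedComponents X) :
        IsOpen {p : X × unitInterval | ConnectedComponents.mk p.1 = c} :=
      (isOpen_discrete {c}).preimage (ConnectedComponents.continuous_coe.comp continuous_fst)
    rw [continuous_iff_continuousAt]
    intro p
    obtain ⟨a, ha⟩ := e.surjective (ConnectedComponents.mk p.1)
    refine ContinuousOn.continuousAt ?_ ((hopen (e a)).mem_nhds ha.symm)
    rw [continuousOn_iff_continuous_domRestrict]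
    have : Set.domRestrict {p : X × unitInterval | ConnectedComponents.mk p.1 = e a} ψ =
        fun p => piece a p.1 p.2 := funext fun p => hψ a p.1 p.2
    rw [this]
    refine continuous_sigmaMk.comp (continuous_quot_mk.comp (Continuous.prodMk ?_ ?_))
    · have := f.symm.continuous.iterate (a.2 : ℕ)
      exact Continuous.subtype_mk (this.comp (continuous_fst.comp continuous_subtype_val)) _
    · exact Continuous.subtype_mk (by fun_prop) _
  have hrep (x : X) : ∃ (N : R)
      (y : {x : X // ConnectedComponents.mk x = (N : ConnectedComponents X)}) (j : ℕ),
      j < n N ∧ (⇑f)^[j] y = x := by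
    obtain ⟨a, ha⟩ := e.surjective (ConnectedComponents.mk x)
    exact ⟨a.1, ⟨_, hmem a x ha.symm⟩, a.2, a.2.2, hright a.2 x⟩
  have hψ_rel (p q : X × unitInterval) (h : mappingTorusRel (⇑f) p q) : ψ p = ψ q := by
    obtain ⟨x, t⟩ := p
    obtain ⟨x', t'⟩ := q
    obtain ⟨rfl, rfl, rfl⟩ : t = 1 ∧ t' = 0 ∧ x' = f x := h
    obtain ⟨N, y, j, hj, rfl⟩ := hrep x
    obtain ⟨s, hs⟩ : ∃ s : unitInterval, (n N : ℝ) * s = j + (1 : unitInterval) := by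
      have : (n N : ℝ) ≠ 0 := by exact_mod_cast (hpos N).ne'
      exact ⟨⟨_, hIcc ⟨N, j, hj⟩ 1⟩, mul_div_cancel₀ _ this⟩
    rw [hψ_apply N y j hj 1 s hs]
    obtain hj' | hj' := Nat.lt_or_ge (j + 1) (n N)
    · rw [← Function.iterate_succ_apply' f, hψ_apply N y (j + 1) hj' 0 s (by simpa using hs)]
    · have hjn : j + 1 = n N := by omega
      have hs1 : s = 1 := by
        have : (n N : ℝ) ≠ 0 := by exact_mod_cast (hpos N).ne'
        refine Subtype.ext (mul_left_cancel₀ this ?_)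
        rw [hs, ← hjn]
        simp
      rw [← Function.iterate_succ_apply' f, Nat.succ_eq_add_one, hjn, ← hg N y,
        hs1, MappingTorus.mk_one]
      exact (hψ_apply N (g N y) 0 (hpos N) 0 0 (by simp)).symm
  let φ (N : R) : MappingTorus (g N) → MappingTorus (⇑f) :=
    Quot.lift (fun p => MappingTorus.flow f p.1 (n N * p.2)) fun p q h => by
      obtain ⟨hp, hq, hpq⟩ := h
      have h1 := MappingTorus.flow_natCast_add f p.1 (n N) 0
      have h2 := MappingTorus.flow_natCast_add f (g N p.1) 0 0
      rw [hp, hq, hpq]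
      simp only [Set.Icc.coe_zero, Set.Icc.coe_one, add_zero, mul_one, mul_zero,
        Nat.cast_zero, Function.iterate_zero, id_eq] at h1 h2 ⊢
      rw [h1, h2, hg]
  have hφ_cont (N : R) : Continuous (φ N) :=
    continuous_quot_lift _ <| (MappingTorus.continuous_flow_mul f.continuous (hpos N)).comp
      (continuous_subtype_val.prodMap continuous_id)
  have hφ_apply (N : R) (y : {x : X // ConnectedComponents.mk x = (N : ConnectedComponents X)})
      (j : ℕ) (t s : unitInterval) (hs : (n N : ℝ) * s = j + t) :
      φ N (Quot.mk _ (y, s)) = Quot.mk _ ((⇑f)^[j] y, t) := by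
    change MappingTorus.flow f y (n N * s) = _
    rw [hs, MappingTorus.flow_natCast_add]
  exact ⟨{
    toFun := Quot.lift ψ hψ_rel
    invFun := fun z => φ z.1 z.2
    left_inv := by
      rintro ⟨x, t⟩
      obtain ⟨N, y, j, hj, rfl⟩ := hrep x
      have : (n N : ℝ) ≠ 0 := by exact_mod_cast (hpos N).ne'
      have hs : (n N : ℝ) * (⟨_, hIcc ⟨N, j, hj⟩ t⟩ : unitInterval) = j + t :=
        mul_div_cancel₀ _ this
      change φ (ψ _).1 (ψ _).2 = _
      rw [hψ_apply N y j hj t _ hs]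
      exact hφ_apply N y j t _ hs
    right_inv := by
      rintro ⟨N, ⟨y, s⟩⟩
      obtain ⟨j, hj, t, hs⟩ := MappingTorus.exists_lt_mul_eq_add (hpos N) s
      change Quot.lift ψ hψ_rel (φ N (Quot.mk _ (y, s))) = _
      rw [hφ_apply N y j t s hs]
      exact hψ_apply N y j hj t s hs
    continuous_toFun := continuous_quot_lift _ hψ_cont
    continuous_invFun := continuous_sigma hφ_cont }⟩

end
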